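/- Under the stated setup, define s₁ ∈ [e, t] by s₁ = e + ((n−1)g(e)/v)·( ( (n·v·(V − ∫_{t₀}^{e} g(x)dx) + (n−1)g(e)²) / (g(e)·(v(t−e) + (n−1)g(e))) )^{1/(n−1)} − 1 ) if v ≠ 0, and s₁ = ( n(V − ∫_{t₀}^{e} g(x)dx) − g(e)(t − n·e) ) / ((n−1)g(e)) if v = 0; and define h₁ : [t₀, t] → ℝ by h₁(x) = h₀(x) for x ∈ [t₀, s₁] and h₁(x) = h₀(s₁)·((t−x)/(t−s₁))^{n−1} for x ∈ [s₁, t]. Then the first coordinate of the barycenter satisfies b₁ ≥ (1/V)·∫_{t₀}^{t} x·h₁(x) dx. -/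

import Mathlib

open MeasureTheory Set Filter

open scoped ENNReal Pointwise

/-- The one-dimensional Brunn–Minkowski inequality. -/
theorem volume_add_volume_le {A B C : Set ℝ} (hA : MeasurableSet A) (hB : MeasurableSet B)
    (hAne : A.Nonempty) (hBne : B.Nonempty) (hC : ∀ x ∈ A, ∀ y ∈ B, x + y ∈ C) :
    volume A + volume B ≤ volume C := by
  have key : ∀ K L : Set ℝ, IsCompact K → IsCompact L → K.Nonempty → L.Nonempty → K ⊆ A →
      L ⊆ B → volume K + volume L ≤ volume C := by
    intro K L hK hL hKne hLne hKA hLB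
    have hS := hK.sSup_mem hKne
    have hI := hL.sInf_mem hLne
    have h1 : volume ((fun x => x + -sInf L) ⁻¹' K) = volume K :=
      measure_preimage_add_right volume _ K
    have h2 : volume ((fun x => x + -sSup K) ⁻¹' L) = volume L :=
      measure_preimage_add_right volume _ L
    have hm1 : MeasurableSet ((fun x => x + -sSup K) ⁻¹' L) :=
      hL.measurableSet.preimage (by fun_prop)
    have hsub : (fun x => x + -sInf L) ⁻¹' K ∩ (fun x => x + -sSup K) ⁻¹' L
        ⊆ {sSup K + sInf L} := by
      rintro x ⟨hx1, hx2⟩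
      have := le_csSup hK.bddAbove hx1
      have := csInf_le hL.bddBelow hx2
      simp only [mem_singleton_iff]
      linarith
    have h0 : volume ((fun x => x + -sInf L) ⁻¹' K ∩ (fun x => x + -sSup K) ⁻¹' L) = 0 :=
      measure_mono_null hsub (by simp)
    rw [← h1, ← h2, ← measure_union_add_inter _ hm1, h0, add_zero]
    refine measure_mono ?_
    rintro x (hx | hx)
    · simpa using hC _ (hKA hx) _ (hLB hI)
    · simpa using hC _ (hKA hS) _ (hLB hx)
  obtain ⟨a, ha⟩ := hAne
  obtain ⟨b, hb⟩ := hBne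
  have key' : ∀ K L : Set ℝ, IsCompact K → IsCompact L → K ⊆ A → L ⊆ B →
      volume K + volume L ≤ volume C := by
    intro K L hK hL hKA hLB
    refine le_trans (add_le_add (measure_mono (subset_insert a K))
      (measure_mono (subset_insert b L))) (key _ _ (hK.insert a) (hL.insert b)
        (insert_nonempty _ _) (insert_nonempty _ _) (insert_subset ha hKA) (insert_subset hb hLB))
  rw [hA.measure_eq_iSup_isCompact, hB.measure_eq_iSup_isCompact]
  simp only [iSup_and', iSup_subtype']
  have : Nonempty {K : Set ℝ // K ⊆ A ∧ IsCompact K} := ⟨∅, by simp⟩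
  have : Nonempty {K : Set ℝ // K ⊆ B ∧ IsCompact K} := ⟨∅, by simp⟩
  exact ENNReal.iSup_add_iSup_le fun K L => key' _ _ K.2.2 L.2.2 K.2.1 L.2.1

theorem ofReal_mul_volume_add_le {a b : ℝ} (ha : 0 < a) (hb : 0 < b) {A B C : Set ℝ}
    (hA : MeasurableSet A) (hB : MeasurableSet B)
    (hAne : A.Nonempty) (hBne : B.Nonempty) (hC : ∀ x ∈ A, ∀ y ∈ B, a * x + b * y ∈ C) :
    ENNReal.ofReal a * volume A + ENNReal.ofReal b * volume B ≤ volume C := by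
  have h := volume_add_volume_le (hA.const_smul₀ a) (hB.const_smul₀ b) hAne.smul_set
    hBne.smul_set (C := C) (by
      rintro _ ⟨x, hx, rfl⟩ _ ⟨y, hy, rfl⟩
      simpa using hC x hx y hy)
  simpa [Measure.addHaar_smul, abs_of_pos ha, abs_of_pos hb] using h

theorem lintegral_eq_lintegral_volume_lt_of_le_one {E : Type*} [MeasurableSpace E]
    {μ : Measure E} {f : E → ℝ≥0∞} (hf : Measurable f) (hf1 : ∀ x, f x ≤ 1) :
    ∫⁻ x, f x ∂μ = ∫⁻ r in Ioo (0 : ℝ) 1, μ {x | ENNReal.ofReal r < f x} := by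
  have hfin : ∀ x, f x ≠ ∞ := fun x => ne_top_of_le_ne_top ENNReal.one_ne_top (hf1 x)
  have h := lintegral_eq_lintegral_meas_lt (f := fun x => (f x).toReal) μ
    (Eventually.of_forall fun x => ENNReal.toReal_nonneg) (by fun_prop)
  simp only [ENNReal.ofReal_toReal (hfin _)] at h
  rw [h, ← Ioo_union_Ici_eq_Ioi (zero_lt_one' ℝ), lintegral_union measurableSet_Ici
    (by
      rw [Set.disjoint_left]
      exact fun x hx hx' => not_le.2 hx.2 hx')]
  have h0 : ∫⁻ r in Ici (1 : ℝ), μ {x | r < (f x).toReal} = 0 := by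
    refine setLIntegral_eq_zero measurableSet_Ici fun r hr => ?_
    have : {x | r < (f x).toReal} = ∅ := by
      ext x
      have := ENNReal.toReal_mono ENNReal.one_ne_top (hf1 x)
      simp only [mem_ofPred_eq, mem_empty_iff_false, iff_false, not_lt]
      exact this.trans (by simpa using hr)
    simp [this]
  rw [h0, add_zero]
  refine setLIntegral_congr_fun measurableSet_Ioo fun r hr => ?_
  simp only [ENNReal.ofReal_lt_iff_lt_toReal hr.1.le (hfin _)]

theorem lintegral_add_le_of_iSup_eq_one {a b : ℝ} (ha : 0 < a) (hb : 0 < b)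
    {f g h : ℝ → ℝ≥0∞} (hf : Measurable f) (hg : Measurable g) (hh : Measurable h)
    (hf1 : ⨆ x, f x = 1) (hg1 : ⨆ x, g x = 1)
    (hfgh : ∀ x y, min (f x) (g y) ≤ h (a * x + b * y)) :
    ENNReal.ofReal a * (∫⁻ x, f x) + ENNReal.ofReal b * ∫⁻ x, g x ≤ ∫⁻ x, h x := by
  have hmeas : ∀ u : ℝ → ℝ≥0∞, Measurable fun r : ℝ => volume {x | ENNReal.ofReal r < u x} :=
    fun u => Antitone.measurable fun r s hrs =>
      measure_mono fun x hx => (ENNReal.ofReal_le_ofReal hrs).trans_lt hx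
  calc ENNReal.ofReal a * (∫⁻ x, f x) + ENNReal.ofReal b * ∫⁻ x, g x
      = ∫⁻ r in Ioo (0 : ℝ) 1, (ENNReal.ofReal a * volume {x | ENNReal.ofReal r < f x} +
          ENNReal.ofReal b * volume {x | ENNReal.ofReal r < g x}) := by
        rw [lintegral_add_left ((hmeas f).const_mul _), lintegral_const_mul _ (hmeas f),
          lintegral_const_mul _ (hmeas g),
          lintegral_eq_lintegral_volume_lt_of_le_one hf fun x => hf1 ▸ le_iSup f x,
          lintegral_eq_lintegral_volume_lt_of_le_one hg fun x => hg1 ▸ le_iSup g x]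
    _ ≤ ∫⁻ r in Ioo (0 : ℝ) 1, volume {x | ENNReal.ofReal r < min (h x) 1} := by
        refine setLIntegral_mono (hmeas _) fun r hr => ?_
        have hr1 : ENNReal.ofReal r < 1 := by simpa using hr.2
        refine ofReal_mul_volume_add_le ha hb (measurableSet_lt measurable_const hf)
          (measurableSet_lt measurable_const hg) (lt_iSup_iff.1 (hr1.trans_eq hf1.symm))
          (lt_iSup_iff.1 (hr1.trans_eq hg1.symm)) fun x hx y hy => ?_
        exact lt_min ((lt_min hx hy).trans_le (hfgh x y)) hr1
    _ = ∫⁻ x, min (h x) 1 :=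
        (lintegral_eq_lintegral_volume_lt_of_le_one (by fun_prop) fun x => min_le_right _ _).symm
    _ ≤ ∫⁻ x, h x := lintegral_mono fun x => min_le_left _ _

theorem ofReal_geom_mean_le_arith_mean {a b : ℝ} (ha : 0 < a) (hb : 0 < b) (hab : a + b = 1)
    (p q : ℝ≥0∞) : p ^ a * q ^ b ≤ ENNReal.ofReal a * p + ENNReal.ofReal b * q := by
  rcases eq_or_ne p ∞ with rfl | hp
  · simp [ENNReal.mul_top, ha]
  rcases eq_or_ne q ∞ with rfl | hq
  · simp [ENNReal.mul_top, hb]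
  lift p to NNReal using hp
  lift q to NNReal using hq
  lift a to NNReal using ha.le
  lift b to NNReal using hb.le
  have := NNReal.geom_mean_le_arith_mean2_weighted a b p q (by exact_mod_cast hab)
  rw [← ENNReal.coe_rpow_of_nonneg _ ha.le, ← ENNReal.coe_rpow_of_nonneg _ hb.le,
    ENNReal.ofReal_coe_nnreal, ENNReal.ofReal_coe_nnreal]
  exact_mod_cast this

/-- The Prékopa–Leindler inequality for bounded functions on the line. -/
theorem prekopaLeindler_real_of_iSup_ne_top {a b : ℝ} (ha : 0 < a) (hb : 0 < b) (hab : a + b = 1)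
    {f g h : ℝ → ℝ≥0∞} (hf : Measurable f) (hg : Measurable g) (hh : Measurable h)
    (hf1 : ⨆ x, f x ≠ ∞) (hg1 : ⨆ x, g x ≠ ∞)
    (hfgh : ∀ x y, f x ^ a * g y ^ b ≤ h (a * x + b * y)) :
    (∫⁻ x, f x) ^ a * (∫⁻ x, g x) ^ b ≤ ∫⁻ x, h x := by
  set M := ⨆ x, f x
  set N := ⨆ x, g x
  rcases eq_or_ne M 0 with hM | hM
  · have : ∀ x, f x = 0 := by simpa [M] using hM
    simp [this, ha]
  rcases eq_or_ne N 0 with hN | hN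
  · have : ∀ x, g x = 0 := by simpa [N] using hN
    simp [this, hb]
  have h0 : ∀ p q : ℝ≥0∞, p ^ a * q ^ b =
      (M ^ a * N ^ b) * ((M⁻¹ * p) ^ a * (N⁻¹ * q) ^ b) := by
    intro p q
    rw [mul_mul_mul_comm, ← ENNReal.mul_rpow_of_nonneg _ _ ha.le,
      ← ENNReal.mul_rpow_of_nonneg _ _ hb.le, ← mul_assoc, ← mul_assoc,
      ENNReal.mul_inv_cancel hM hf1, ENNReal.mul_inv_cancel hN hg1, one_mul, one_mul]
  have hD0 : M ^ a * N ^ b ≠ 0 := by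
    simp [hM, hN, hf1, hg1]
  have hD1 : M ^ a * N ^ b ≠ ∞ := by
    finiteness
  have key := lintegral_add_le_of_iSup_eq_one ha hb (hf.const_mul M⁻¹) (hg.const_mul N⁻¹)
    (hh.const_mul (M ^ a * N ^ b)⁻¹) (by rw [← ENNReal.mul_iSup, ENNReal.inv_mul_cancel hM hf1])
    (by rw [← ENNReal.mul_iSup, ENNReal.inv_mul_cancel hN hg1]) (by
      intro x y
      refine le_trans ?_ (mul_le_mul_right (hfgh x y) _)
      rw [h0 (f x), ← mul_assoc, ENNReal.inv_mul_cancel hD0 hD1, one_mul]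
      set m := min (M⁻¹ * f x) (N⁻¹ * g y)
      calc m = m ^ a * m ^ b := by
            rw [← ENNReal.rpow_add_of_nonneg _ _ ha.le hb.le, hab, ENNReal.rpow_one]
        _ ≤ _ := by
            gcongr
            · exact min_le_left _ _
            · exact min_le_right _ _)
  have := (ofReal_geom_mean_le_arith_mean ha hb hab _ _).trans key
  rw [lintegral_const_mul _ hf, lintegral_const_mul _ hg, lintegral_const_mul _ hh] at this
  rw [h0]
  calc _ ≤ (M ^ a * N ^ b) * ((M ^ a * N ^ b)⁻¹ * ∫⁻ x, h x) := by gcongr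
    _ = _ := by rw [← mul_assoc, ENNReal.mul_inv_cancel hD0 hD1, one_mul]

/-- The measure space `E` satisfies the Prékopa–Leindler inequality with weights `a` and `b`. -/
def PrekopaLeindler (E : Type*) [AddCommGroup E] [Module ℝ E] [MeasureSpace E] (a b : ℝ) : Prop :=
  ∀ f g h : E → ℝ≥0∞, Measurable f → Measurable g → Measurable h →
    (∀ x y, f x ^ a * g y ^ b ≤ h (a • x + b • y)) →
      (∫⁻ x, f x) ^ a * (∫⁻ x, g x) ^ b ≤ ∫⁻ x, h x

theorem lintegral_eq_iSup_lintegral_min_natCast {E : Type*} [MeasurableSpace E] {μ : Measure E}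
    {f : E → ℝ≥0∞} (hf : Measurable f) : ∫⁻ x, f x ∂μ = ⨆ k : ℕ, ∫⁻ x, min (f x) k ∂μ := by
  rw [← lintegral_iSup (f := fun (k : ℕ) x => min (f x) k) (fun k => by fun_prop) fun k l hkl x =>
    min_le_min_left _ (by exact_mod_cast hkl)]
  refine lintegral_congr fun x => ?_
  rw [← inf_iSup_eq, ENNReal.iSup_natCast, inf_top_eq]

theorem prekopaLeindler_real {a b : ℝ} (ha : 0 < a) (hb : 0 < b) (hab : a + b = 1) :
    PrekopaLeindler ℝ a b := by
  intro f g h hf hg hh hfgh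
  rw [lintegral_eq_iSup_lintegral_min_natCast hf, lintegral_eq_iSup_lintegral_min_natCast hg,
    ← ENNReal.orderIsoRpow_apply a ha, ← ENNReal.orderIsoRpow_apply b hb, OrderIso.map_iSup,
    OrderIso.map_iSup]
  simp only [ENNReal.orderIsoRpow_apply, ENNReal.iSup_mul, ENNReal.mul_iSup]
  refine iSup_le fun k => iSup_le fun l => ?_
  have hb' : ∀ (u : ℝ → ℝ≥0∞) (m : ℕ), ⨆ x, min (u x) m ≠ ∞ := fun u m =>
    ne_top_of_le_ne_top (ENNReal.natCast_ne_top m) (iSup_le fun x => min_le_right _ _)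
  refine prekopaLeindler_real_of_iSup_ne_top ha hb hab (by fun_prop) (by fun_prop) hh (hb' _ _)
    (hb' _ _) fun x y => le_trans ?_ (hfgh x y)
  gcongr
  · exact min_le_left _ _
  · exact min_le_left _ _

theorem PrekopaLeindler.prod {E F : Type*} [AddCommGroup E] [Module ℝ E] [MeasureSpace E]
    [AddCommGroup F] [Module ℝ F] [MeasureSpace F] [SFinite (volume : Measure F)] {a b : ℝ}
    (hE : PrekopaLeindler E a b) (hF : PrekopaLeindler F a b) : PrekopaLeindler (E × F) a b := by
  intro f g h hf hg hh hfgh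
  rw [Measure.volume_eq_prod, lintegral_prod _ hf.aemeasurable, lintegral_prod _ hg.aemeasurable,
    lintegral_prod _ hh.aemeasurable]
  refine hE _ _ _ hf.lintegral_prod_right' hg.lintegral_prod_right' hh.lintegral_prod_right'
    fun x y => hF _ _ _ (by fun_prop) (by fun_prop) (by fun_prop) fun z w => ?_
  exact hfgh (x, z) (y, w)

theorem PrekopaLeindler.of_measurePreserving {E F : Type*} [AddCommGroup E] [Module ℝ E]
    [MeasureSpace E] [AddCommGroup F] [Module ℝ F] [MeasureSpace F] {a b : ℝ}
    (hE : PrekopaLeindler E a b) (φ : E ≃ᵐ F) (hφ : MeasurePreserving φ)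
    (hlin : ∀ x y, φ (a • x + b • y) = a • φ x + b • φ y) : PrekopaLeindler F a b := by
  intro f g h hf hg hh hfgh
  rw [← hφ.lintegral_comp hf, ← hφ.lintegral_comp hg, ← hφ.lintegral_comp hh]
  refine hE _ _ _ (hf.comp φ.measurable) (hg.comp φ.measurable) (hh.comp φ.measurable)
    fun x y => ?_
  simpa [hlin] using hfgh (φ x) (φ y)

/-- The Prékopa–Leindler inequality. -/
theorem prekopaLeindler_pi {a b : ℝ} (ha : 0 < a) (hb : 0 < b) (hab : a + b = 1) (m : ℕ) :
    PrekopaLeindler (Fin m → ℝ) a b := by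
  induction m with
  | zero =>
    intro f g h hf hg hh hfgh
    simpa [Measure.volume_pi_eq_dirac (0 : Fin 0 → ℝ)] using hfgh 0 0
  | succ m ih =>
    refine ((prekopaLeindler_real ha hb hab).prod ih).of_measurePreserving
      (MeasurableEquiv.piFinSuccAbove (fun _ => ℝ) 0).symm
      (volume_preserving_piFinSuccAbove (fun _ => ℝ) 0).symm fun x y => ?_
    rw [MeasurableEquiv.symm_apply_eq]
    ext i
    · simp [MeasurableEquiv.piFinSuccAbove]
    · simp [MeasurableEquiv.piFinSuccAbove, Fin.tail]

theorem volume_real_smul_pi {m : ℕ} {r : ℝ} (hr : 0 ≤ r) (s : Set (Fin m → ℝ)) :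
    volume.real (r • s) = r ^ m * volume.real s := by
  rw [Measure.real, Measure.addHaar_smul, ENNReal.toReal_mul, ENNReal.toReal_ofReal (abs_nonneg _),
    Module.finrank_fin_fun, abs_of_nonneg (by positivity), Measure.real]

/-- The Brunn–Minkowski inequality. -/
theorem pow_add_le_volume_real {a b : ℝ} (ha : 0 < a) (hb : 0 < b) {m : ℕ}
    {A B C : Set (Fin m → ℝ)} (hA : MeasurableSet A) (hB : MeasurableSet B)
    (hC : MeasurableSet C) (hCfin : volume C ≠ ∞) (hAne : A.Nonempty) (hBne : B.Nonempty)
    (hABC : ∀ x ∈ A, ∀ y ∈ B, a • x + b • y ∈ C)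
    {α β : ℝ} (hα : 0 ≤ α) (hβ : 0 ≤ β) (hαA : α ^ m = volume.real A)
    (hβB : β ^ m = volume.real B) : (a * α + b * β) ^ m ≤ volume.real C := by
  rcases hα.eq_or_lt with rfl | hα
  · obtain ⟨x, hx⟩ := hAne
    have hsub : (a • x) +ᵥ (b • B) ⊆ C := by
      rintro _ ⟨_, ⟨y, hy, rfl⟩, rfl⟩
      exact hABC x hx y hy
    have := measureReal_mono hsub hCfin
    rw [measureReal_def, measure_vadd, ← measureReal_def, volume_real_smul_pi hb.le, ← hβB] at this
    simpa [mul_pow] using this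
  rcases hβ.eq_or_lt with rfl | hβ
  · obtain ⟨y, hy⟩ := hBne
    have hsub : (b • y) +ᵥ (a • A) ⊆ C := by
      rintro _ ⟨_, ⟨x, hx, rfl⟩, rfl⟩
      simpa [add_comm] using hABC x hx y hy
    have := measureReal_mono hsub hCfin
    rw [measureReal_def, measure_vadd, ← measureReal_def, volume_real_smul_pi ha.le, ← hαA] at this
    simpa [mul_pow] using this
  set D := a * α + b * β with hD
  have hDpos : 0 < D := by positivity
  have unit : ∀ (γ : ℝ) (S : Set (Fin m → ℝ)), 0 < γ → γ ^ m = volume.real S →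
      volume (γ⁻¹ • S) = 1 := by
    intro γ S hγ h
    have h1 : volume.real (γ⁻¹ • S) = 1 := by
      rw [volume_real_smul_pi (by positivity), ← h, inv_pow, inv_mul_cancel₀ (by positivity)]
    rw [← ENNReal.toReal_eq_one_iff]
    exact h1
  have hA' := hA.const_smul₀ α⁻¹
  have hB' := hB.const_smul₀ β⁻¹
  have hC' := hC.const_smul₀ D⁻¹
  have hpl := prekopaLeindler_pi (a := a * α / D) (b := b * β / D) (by positivity) (by positivity)
    (by rw [← add_div, div_self hDpos.ne']) m
    ((α⁻¹ • A).indicator 1) ((β⁻¹ • B).indicator 1) ((D⁻¹ • C).indicator 1)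
    (measurable_one.indicator hA') (measurable_one.indicator hB') (measurable_one.indicator hC') (by
      intro x y
      by_cases hx : x ∈ α⁻¹ • A
      · by_cases hy : y ∈ β⁻¹ • B
        · obtain ⟨x, hx, rfl⟩ := hx
          obtain ⟨y, hy, rfl⟩ := hy
          have hmem : (a * α / D) • α⁻¹ • x + (b * β / D) • β⁻¹ • y ∈ D⁻¹ • C := by
            refine ⟨_, hABC x hx y hy, ?_⟩
            simp only [smul_add, smul_smul]
            congr 2 <;> field_simp
          simp only [indicator_of_mem hmem, Pi.one_apply]
          refine mul_le_one' (ENNReal.rpow_le_one ?_ (by positivity))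
            (ENNReal.rpow_le_one ?_ (by positivity)) <;>
          exact indicator_le_self' (fun _ _ => zero_le_one) _
        · have : 0 < b * β / D := by positivity
          simp [hy, this]
      · have : 0 < a * α / D := by positivity
        simp [hx, this])
  rw [lintegral_indicator_one hA', lintegral_indicator_one hB', lintegral_indicator_one hC',
    unit α A hα hαA, unit β B hβ hβB, ENNReal.one_rpow, ENNReal.one_rpow, one_mul] at hpl
  have hfin : volume (D⁻¹ • C) ≠ ∞ := by
    rw [Measure.addHaar_smul]
    finiteness
  have h1 : 1 ≤ volume.real (D⁻¹ • C) := by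
    rw [← ENNReal.toReal_one]
    exact ENNReal.toReal_mono hfin hpl
  rw [volume_real_smul_pi (by positivity), inv_pow, le_inv_mul_iff₀ (by positivity), mul_one] at h1
  exact h1

/-- Brunn's theorem: the suitably normalised volume of the slices of a convex body is concave. -/
theorem concaveOn_rpow_volume_slice {m : ℕ} (hm : m ≠ 0) {Δ : Set (ℝ × (Fin m → ℝ))}
    (hcomp : IsCompact Δ) (hconv : Convex ℝ Δ) :
    ConcaveOn ℝ (Prod.fst '' Δ)
      fun x => (volume {y : Fin m → ℝ | (x, y) ∈ Δ}).toReal ^ ((m : ℝ)⁻¹) := by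
  have hslice : ∀ x : ℝ, IsCompact {y : Fin m → ℝ | (x, y) ∈ Δ} := fun x =>
    (hcomp.image continuous_snd).of_isClosed_subset
      (hcomp.isClosed.preimage (Continuous.prodMk_right x)) fun y hy => ⟨(x, y), hy, rfl⟩
  have hne : ∀ x ∈ Prod.fst '' Δ, {y : Fin m → ℝ | (x, y) ∈ Δ}.Nonempty := by
    rintro _ ⟨p, hp, rfl⟩
    exact ⟨p.2, hp⟩
  refine concaveOn_iff_forall_pos.2 ⟨hconv.linear_image (LinearMap.fst ℝ ℝ _),
    fun x hx y hy a b ha hb hab => ?_⟩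
  simp only [smul_eq_mul]
  have := pow_add_le_volume_real (C := {z : Fin m → ℝ | (a * x + b * y, z) ∈ Δ}) ha hb
    (hslice x).measurableSet (hslice y).measurableSet
    (hslice _).measurableSet (hslice _).measure_lt_top.ne (hne x hx) (hne y hy)
    (fun z hz w hw => hconv hz hw ha.le hb.le hab)
    (Real.rpow_nonneg ENNReal.toReal_nonneg _) (Real.rpow_nonneg ENNReal.toReal_nonneg _)
    (Real.rpow_inv_natCast_pow ENNReal.toReal_nonneg hm)
    (Real.rpow_inv_natCast_pow ENNReal.toReal_nonneg hm)
  rw [Real.le_rpow_inv_iff_of_pos (by positivity) ENNReal.toReal_nonneg (by positivity),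
    Real.rpow_natCast]
  exact this

theorem IsCompact.setIntegral_fst_eq {m : ℕ} {Δ : Set (ℝ × (Fin m → ℝ))} (hΔ : IsCompact Δ)
    {a b : ℝ} (hab : a ≤ b) (hproj : Prod.fst '' Δ = Icc a b) {F : ℝ → ℝ} (hF : Continuous F) :
    IntervalIntegrable
        (fun x => F x * (volume {y : Fin m → ℝ | (x, y) ∈ Δ}).toReal) volume a b ∧
      ∫ p in Δ, F p.1 = ∫ x in a..b, F x * (volume {y : Fin m → ℝ | (x, y) ∈ Δ}).toReal := by
  have hint : Integrable (Δ.indicator fun p => F p.1) :=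
    (integrable_indicator_iff hΔ.measurableSet).2
      ((hF.comp continuous_fst).continuousOn.integrableOn_compact hΔ)
  have hslice : ∀ x : ℝ, ∫ y : Fin m → ℝ, Δ.indicator (fun p => F p.1) (x, y) =
      F x * (volume {y : Fin m → ℝ | (x, y) ∈ Δ}).toReal := by
    intro x
    have hm : MeasurableSet {y : Fin m → ℝ | (x, y) ∈ Δ} :=
      hΔ.measurableSet.preimage measurable_prodMk_left
    have : (fun y : Fin m → ℝ => Δ.indicator (fun p => F p.1) (x, y)) =
        {y : Fin m → ℝ | (x, y) ∈ Δ}.indicator fun _ => F x := by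
      ext y
      by_cases h : (x, y) ∈ Δ <;> simp [h]
    rw [this, integral_indicator_const _ hm, smul_eq_mul, mul_comm, Measure.real]
  rw [Measure.volume_eq_prod] at hint
  constructor
  · have := hint.integral_prod_left
    simp only [hslice] at this
    exact this.intervalIntegrable
  · rw [← integral_indicator hΔ.measurableSet, Measure.volume_eq_prod, integral_prod _ hint]
    simp only [hslice]
    rw [intervalIntegral.integral_of_le hab, ← integral_Icc_eq_integral_Ioc,
      setIntegral_eq_integral_of_forall_compl_eq_zero]
    intro x hx
    have : {y : Fin m → ℝ | (x, y) ∈ Δ} = ∅ :=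
      eq_empty_of_forall_notMem fun y hy => hx (hproj ▸ ⟨(x, y), hy, rfl⟩)
    simp [this]

theorem ConcaveOn.le_tangent_of_tendsto_slope {a b e w : ℝ} {φ : ℝ → ℝ}
    (hφ : ConcaveOn ℝ (Icc a b) φ) (he : e ∈ Ioo a b)
    (hw : HasDerivWithinAt φ w (Ioi e) e ∨ HasDerivWithinAt φ w (Iio e) e) {x : ℝ}
    (hx : x ∈ Icc e b) : φ x ≤ φ e + w * (x - e) := by
  rcases hx.1.eq_or_lt with rfl | hex
  · simp
  have hanti := hφ.slope_anti (Ioo_subset_Icc_self he)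
  have hmem : ∀ y ∈ Ioo a x, y ≠ e → slope φ e x ≤ slope φ e y := fun y hy hye =>
    hanti ⟨⟨hy.1.le, hy.2.le.trans hx.2⟩, hye⟩ ⟨⟨he.1.le.trans hx.1, hx.2⟩, hex.ne'⟩ hy.2.le
  have hnhds : Ioo a x ∈ nhds e := Ioo_mem_nhds he.1 hex
  have hle : slope φ e x ≤ w := by
    rcases hw with hw | hw
    · rw [hasDerivWithinAt_iff_tendsto_slope' self_notMem_Ioi] at hw
      refine ge_of_tendsto hw ?_
      filter_upwards [mem_nhdsWithin_of_mem_nhds hnhds, self_mem_nhdsWithin] with y hy hye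
      exact hmem y hy (ne_of_gt hye)
    · rw [hasDerivWithinAt_iff_tendsto_slope' self_notMem_Iio] at hw
      refine ge_of_tendsto hw ?_
      filter_upwards [mem_nhdsWithin_of_mem_nhds hnhds, self_mem_nhdsWithin] with y hy hye
      exact hmem y hy (ne_of_lt hye)
  rw [slope_def_field, div_le_iff₀ (sub_pos.2 hex)] at hle
  linarith

theorem rpow_inv_le_tangent {m : ℕ} {a b e v : ℝ} {g : ℝ → ℝ}
    (hφ : ConcaveOn ℝ (Icc a b) fun x => g x ^ ((m : ℝ)⁻¹)) (he : e ∈ Ioo a b) (hge : 0 < g e)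
    (hv : Tendsto (fun x => (g x - g e) / (x - e)) (nhdsWithin e (Ioi e)) (nhds v)
      ∨ Tendsto (fun x => (g x - g e) / (x - e)) (nhdsWithin e (Iio e)) (nhds v)) {x : ℝ}
    (hx : x ∈ Icc e b) :
    g x ^ ((m : ℝ)⁻¹) ≤ g e ^ ((m : ℝ)⁻¹) * (1 + v / (m * g e) * (x - e)) := by
  have hw : HasDerivWithinAt g v (Ioi e) e ∨ HasDerivWithinAt g v (Iio e) e := by
    rw [hasDerivWithinAt_iff_tendsto_slope' self_notMem_Ioi,
      hasDerivWithinAt_iff_tendsto_slope' self_notMem_Iio]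
    simpa only [funext (slope_def_field g e)] using hv
  have h := hφ.le_tangent_of_tendsto_slope he
    (hw.imp (fun h => h.rpow_const (.inl hge.ne')) fun h => h.rpow_const (.inl hge.ne')) hx
  refine h.trans_eq ?_
  rw [Real.rpow_sub_one hge.ne']
  rw [div_mul_eq_div_div, div_eq_mul_inv v]
  ring

theorem ConcaveOn.exists_crossing {s t : ℝ} (hst : s ≤ t) {ψ : ℝ → ℝ}
    (hψ : ConcaveOn ℝ (Icc s t) ψ) (ht : 0 ≤ ψ t) :
    ∃ c ∈ Icc s t, ∀ x ∈ Icc s t, (x < c → ψ x ≤ 0) ∧ (c < x → 0 ≤ ψ x) := by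
  set S := {x ∈ Icc s t | 0 ≤ ψ x} with hS
  have htS : t ∈ S := ⟨right_mem_Icc.2 hst, ht⟩
  have hbdd : BddBelow S := ⟨s, fun x hx => hx.1.1⟩
  have hord : OrdConnected S := (hψ.convex_ge 0).ordConnected
  refine ⟨sInf S, ⟨le_csInf ⟨t, htS⟩ fun x hx => hx.1.1, csInf_le hbdd htS⟩,
    fun x hx => ⟨fun h => ?_, fun h => ?_⟩⟩
  · by_contra! hpos
    exact notMem_of_lt_csInf h hbdd ⟨hx, hpos.le⟩
  · obtain ⟨y, hy, hyx⟩ := exists_lt_of_csInf_lt ⟨t, htS⟩ h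
    exact (hord.out hy htS ⟨hyx.le, hx.2⟩).2

theorem integral_one_add_mul_pow (k e s : ℝ) (m : ℕ) :
    k * (m + 1) * ∫ x in e..s, (1 + k * (x - e)) ^ m = (1 + k * (s - e)) ^ (m + 1) - 1 := by
  rw [← intervalIntegral.integral_const_mul, intervalIntegral.integral_eq_sub_of_hasDerivAt
    (f := fun x => (1 + k * (x - e)) ^ (m + 1))]
  · simp
  · intro x _
    have := ((((hasDerivAt_id x).sub_const e).const_mul k).const_add 1).pow (m + 1)
    refine this.congr_deriv ?_
    simp
    ring
  · exact Continuous.intervalIntegrable (by fun_prop) _ _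

theorem integral_cone_pow {s t : ℝ} (hst : s < t) (m : ℕ) :
    ∫ x in s..t, ((t - x) / (t - s)) ^ m = (t - s) / (m + 1) := by
  rw [intervalIntegral.integral_eq_sub_of_hasDerivAt
    (f := fun x => -(t - s) / (m + 1) * ((t - x) / (t - s)) ^ (m + 1))]
  · have : t - s ≠ 0 := (sub_pos.2 hst).ne'
    simp [this]
    ring
  · intro x _
    have h0 : t - s ≠ 0 := (sub_pos.2 hst).ne'
    have h1 : (m : ℝ) + 1 ≠ 0 := by positivity
    have := ((((hasDerivAt_id x).const_sub t).div_const (t - s)).pow (m + 1)).const_mul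
      (-(t - s) / (m + 1))
    refine this.congr_deriv ?_
    simp
    field_simp
    ring
  · exact Continuous.intervalIntegrable (by fun_prop) _ _

/-- If `g` dominates `h` only to the right of a single crossing point, and `g` has no less total
mass than `h` to the right of `e`, then `g` has the larger first moment. -/
theorem integral_mul_le_of_crossing {e c t b : ℝ} (hct : c ≤ t) (het : e ≤ t) (htb : t ≤ b)
    {g h : ℝ → ℝ} (hg : IntervalIntegrable g volume e b) (hh : IntervalIntegrable h volume e t)
    (hg0 : ∀ x ∈ Icc t b, 0 ≤ g x) (hgh : ∀ x ∈ Icc e t, 0 ≤ (x - c) * (g x - h x))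
    (hint : ∫ x in e..b, g x = ∫ x in e..t, h x) :
    ∫ x in e..t, x * h x ≤ ∫ x in e..b, x * g x := by
  have hg1 : IntervalIntegrable g volume e t := hg.mono_set (by
    rw [uIcc_of_le het, uIcc_of_le (het.trans htb)]
    exact Icc_subset_Icc_right htb)
  have hg2 : IntervalIntegrable g volume t b := hg.mono_set (by
    rw [uIcc_of_le htb, uIcc_of_le (het.trans htb)]
    exact Icc_subset_Icc_left het)
  have hid : ∀ a b : ℝ, ContinuousOn (fun x : ℝ => x) (uIcc a b) := fun a b => continuousOn_id
  have hxg1 := hg1.continuousOn_mul (hid _ _)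
  have hxg2 := hg2.continuousOn_mul (hid _ _)
  have hxh := hh.continuousOn_mul (hid _ _)
  have i1 : 0 ≤ ∫ x in e..t, (x - c) * (g x - h x) := intervalIntegral.integral_nonneg het hgh
  have i2 : 0 ≤ ∫ x in t..b, (x - t) * g x := intervalIntegral.integral_nonneg htb fun x hx =>
    mul_nonneg (sub_nonneg.2 hx.1) (hg0 x hx)
  have i3 : 0 ≤ ∫ x in t..b, g x := intervalIntegral.integral_nonneg htb hg0
  have e1 : ∫ x in e..t, (x - c) * (g x - h x) = ((∫ x in e..t, x * g x) - ∫ x in e..t, x * h x)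
      - c * ((∫ x in e..t, g x) - ∫ x in e..t, h x) := by
    rw [← intervalIntegral.integral_sub hxg1 hxh, ← intervalIntegral.integral_sub hg1 hh,
      ← intervalIntegral.integral_const_mul,
      ← intervalIntegral.integral_sub (hxg1.sub hxh) ((hg1.sub hh).const_mul c)]
    congr 1
    ext x
    ring
  have e2 : ∫ x in t..b, (x - t) * g x = (∫ x in t..b, x * g x) - t * ∫ x in t..b, g x := by
    rw [← intervalIntegral.integral_const_mul,
      ← intervalIntegral.integral_sub hxg2 (hg2.const_mul t)]
    congr 1
    ext x
    ring
  rw [← intervalIntegral.integral_add_adjacent_intervals hg1 hg2] at hint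
  rw [← intervalIntegral.integral_add_adjacent_intervals hxg1 hxg2]
  have := mul_nonneg (sub_nonneg.2 hct) i3
  have e3 : (∫ x in e..t, g x) - ∫ x in e..t, h x = -∫ x in t..b, g x := by linarith
  rw [e3] at e1
  linarith

theorem mass_eq_of_junction {m : ℕ} (hm : m ≠ 0) {γ v W e t s : ℝ} (hγ : 0 < γ) (hW : 0 ≤ W)
    (hLt : 0 ≤ 1 + v / (m * γ) * (t - e))
    (hWle : W ≤ γ * ∫ x in e..t, (1 + v / (m * γ) * (x - e)) ^ m)
    (hWeq : 1 + v / (m * γ) * (t - e) = 0 →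
      W = γ * ∫ x in e..t, (1 + v / (m * γ) * (x - e)) ^ m)
    (hsv : v ≠ 0 → s = e + (m * γ / v) * (((((m : ℝ) + 1) * v * W + m * γ ^ 2) /
      (γ * (v * (t - e) + m * γ))) ^ ((1 : ℝ) / m) - 1))
    (hs0 : v = 0 → s = (((m : ℝ) + 1) * W - γ * (t - ((m : ℝ) + 1) * e)) / (m * γ)) :
    γ * (∫ x in e..s, (1 + v / (m * γ) * (x - e)) ^ m) +
      γ * (1 + v / (m * γ) * (s - e)) ^ m * ((t - s) / (m + 1)) = W := by
  have hm0 : (m : ℝ) ≠ 0 := by exact_mod_cast hm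
  have hmpos : (0 : ℝ) < m := by positivity
  have hm1 : (m : ℝ) + 1 ≠ 0 := by positivity
  rcases eq_or_ne v 0 with rfl | hv
  · rw [hs0 rfl]
    simp
    field_simp
    ring
  set k := v / (m * γ) with hk
  have hvk : v = k * (m * γ) := by rw [hk]; field_simp
  have hk0 : k ≠ 0 := by positivity
  have hIt := integral_one_add_mul_pow k e t m
  have hIs := integral_one_add_mul_pow k e s m
  have hratio : (((m : ℝ) + 1) * v * W + m * γ ^ 2) / (γ * (v * (t - e) + m * γ)) =
      (k * (m + 1) * W / γ + 1) / (1 + k * (t - e)) := by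
    rw [show ((m : ℝ) + 1) * v * W + m * γ ^ 2 = (m * γ ^ 2) * (k * (m + 1) * W / γ + 1) by
      rw [hvk]; field_simp,
      show γ * (v * (t - e) + m * γ) = (m * γ ^ 2) * (1 + k * (t - e)) by rw [hvk]; ring,
      mul_div_mul_left _ _ (by positivity)]
  have hLs : 1 + k * (s - e) =
      ((k * (m + 1) * W / γ + 1) / (1 + k * (t - e))) ^ ((1 : ℝ) / m) := by
    rw [← hratio, hsv hv, hvk]
    field_simp
    ring
  have hkey : (1 + k * (s - e)) ^ m * (1 + k * (t - e)) = k * (m + 1) * W / γ + 1 := by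
    rcases hLt.eq_or_lt with h0 | hpos
    · rw [← h0, mul_zero, hWeq h0.symm, mul_div_assoc, mul_div_cancel_left₀ _ hγ.ne', hIt, ← h0]
      simp
    · have hnum : 0 ≤ k * (m + 1) * W / γ + 1 := by
        rcases lt_or_gt_of_ne hk0 with hneg | hkpos
        · have h1 : W / γ ≤ ∫ x in e..t, (1 + k * (x - e)) ^ m := by
            rw [div_le_iff₀ hγ]; linarith
          have h2 := mul_le_mul_of_nonpos_left h1
            (mul_nonpos_of_nonpos_of_nonneg hneg.le (by positivity : (0 : ℝ) ≤ m + 1))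
          rw [hIt] at h2
          have := pow_nonneg hLt (m + 1)
          rw [mul_div_assoc]
          linarith
        · positivity
      rw [hLs, one_div, Real.rpow_inv_natCast_pow (by positivity) hm, div_mul_cancel₀ _ hpos.ne']
  have hfac : k * (m + 1) ≠ 0 := mul_ne_zero hk0 hm1
  refine mul_left_cancel₀ hfac ?_
  have h1 : k * (m + 1) * W = γ * ((1 + k * (s - e)) ^ m * (1 + k * (t - e)) - 1) := by
    rw [hkey]; field_simp; ring
  rw [h1, mul_add, mul_left_comm _ γ, hIs]
  field_simp
  ring

theorem exists_crossing_cone {m : ℕ} (hm : m ≠ 0) {a b e s t k : ℝ} {g h : ℝ → ℝ}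
    (hφ : ConcaveOn ℝ (Icc a b) fun x => g x ^ ((m : ℝ)⁻¹)) (hg0 : ∀ x, 0 ≤ g x)
    (he : a ≤ e) (htb : t ≤ b) (hes : e ≤ s) (hst : s ≤ t)
    (htan : ∀ x ∈ Icc e t, g x ≤ g e * (1 + k * (x - e)) ^ m)
    (hLs : 0 ≤ 1 + k * (s - e))
    (hh : ∀ x ∈ Icc e s, h x = g e * (1 + k * (x - e)) ^ m)
    (hh' : ∀ x ∈ Ioc s t,
      h x = g e * (1 + k * (s - e)) ^ m * ((t - x) / (t - s)) ^ m) :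
    ∃ c ≤ t, ∀ x ∈ Icc e t, 0 ≤ (x - c) * (g x - h x) := by
  rcases hst.eq_or_lt with rfl | hst'
  · refine ⟨s, le_rfl, fun x hx => mul_nonneg_of_nonpos_of_nonpos (sub_nonpos.2 hx.2) ?_⟩
    rw [hh x hx, sub_nonpos]
    exact htan x hx
  set ℓ : ℝ → ℝ := fun x => g e ^ ((m : ℝ)⁻¹) * (1 + k * (s - e)) * ((t - x) / (t - s)) with hℓ
  have hℓpow : ∀ x, ℓ x ^ m = g e * (1 + k * (s - e)) ^ m * ((t - x) / (t - s)) ^ m := fun x => by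
    rw [hℓ, mul_pow, mul_pow, Real.rpow_inv_natCast_pow (hg0 e) hm]
  have hℓ0 : ∀ x ≤ t, 0 ≤ ℓ x := fun x hx =>
    mul_nonneg (mul_nonneg (Real.rpow_nonneg (hg0 e) _) hLs)
      (div_nonneg (sub_nonneg.2 hx) (sub_nonneg.2 hst))
  have hconc : ConcaveOn ℝ (Icc s t) fun x => g x ^ ((m : ℝ)⁻¹) - ℓ x := by
    refine (hφ.subset (Icc_subset_Icc (he.trans hes) htb) (convex_Icc _ _)).sub
      ⟨convex_Icc _ _, fun x _ y _ p q _ _ hpq => le_of_eq ?_⟩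
    obtain rfl : q = 1 - p := by linarith
    simp only [hℓ, smul_eq_mul]
    ring
  obtain ⟨c, hc, hcross⟩ := hconc.exists_crossing hst (by
    simpa [hℓ] using Real.rpow_nonneg (hg0 t) _)
  have hgpow : ∀ x, (g x ^ ((m : ℝ)⁻¹)) ^ m = g x := fun x =>
    Real.rpow_inv_natCast_pow (hg0 x) hm
  refine ⟨c, hc.2, fun x hx => ?_⟩
  rcases le_or_gt x s with hxs | hsx
  · refine mul_nonneg_of_nonpos_of_nonpos (by linarith [hc.1]) ?_
    rw [hh x ⟨hx.1, hxs⟩, sub_nonpos]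
    exact htan x hx
  rw [hh' x ⟨hsx, hx.2⟩, ← hℓpow, ← hgpow x]
  rcases lt_trichotomy x c with hxc | rfl | hcx
  · refine mul_nonneg_of_nonpos_of_nonpos (sub_nonpos.2 hxc.le) (sub_nonpos.2 ?_)
    exact pow_le_pow_left₀ (Real.rpow_nonneg (hg0 x) _)
      (sub_nonpos.1 ((hcross x ⟨hsx.le, hx.2⟩).1 hxc)) m
  · simp
  · refine mul_nonneg (sub_nonneg.2 hcx.le) (sub_nonneg.2 ?_)
    exact pow_le_pow_left₀ (hℓ0 x hx.2) (sub_nonneg.1 ((hcross x ⟨hsx.le, hx.2⟩).2 hcx)) m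

theorem integral_mul_cone_le {m : ℕ} (hm : m ≠ 0) {a b e s t v : ℝ} {g h : ℝ → ℝ}
    (hφ : ConcaveOn ℝ (Icc a b) fun x => g x ^ ((m : ℝ)⁻¹)) (hg0 : ∀ x, 0 ≤ g x)
    (hgint : IntervalIntegrable g volume e b) (he : e ∈ Ioo a b) (hge : 0 < g e)
    (hv : Tendsto (fun x => (g x - g e) / (x - e)) (nhdsWithin e (Ioi e)) (nhds v)
      ∨ Tendsto (fun x => (g x - g e) / (x - e)) (nhdsWithin e (Iio e)) (nhds v))
    (ht : t ∈ Ioc e b)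
    (htV : ∫ x in e..b, g x ≤ ∫ x in e..t, g e * (1 + v / (m * g e) * (x - e)) ^ m)
    (hsv : v ≠ 0 → s = e + (m * g e / v) *
      (((((m : ℝ) + 1) * v * (∫ x in e..b, g x) + m * g e ^ 2) /
        (g e * (v * (t - e) + m * g e))) ^ ((1 : ℝ) / m) - 1))
    (hs0 : v = 0 → s = (((m : ℝ) + 1) * (∫ x in e..b, g x) -
      g e * (t - ((m : ℝ) + 1) * e)) / (m * g e))
    (hs : s ∈ Icc e t)
    (hh : ∀ x ∈ Icc e s, h x = g e * (1 + v / (m * g e) * (x - e)) ^ m)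
    (hh' : ∀ x ∈ Ioc s t,
      h x = g e * (1 + v / (m * g e) * (s - e)) ^ m * ((t - x) / (t - s)) ^ m) :
    IntervalIntegrable h volume e t ∧ ∫ x in e..t, x * h x ≤ ∫ x in e..b, x * g x := by
  have hφe : 0 < g e ^ ((m : ℝ)⁻¹) := Real.rpow_pos_of_pos hge _
  have htan := fun x (hx : x ∈ Icc e b) => rpow_inv_le_tangent hφ he hge hv hx
  set k := v / (m * g e) with hk
  have hL : ∀ x ∈ Icc e b, 0 ≤ 1 + k * (x - e) := fun x hx =>
    nonneg_of_mul_nonneg_right ((Real.rpow_nonneg (hg0 x) _).trans (htan x hx)) hφe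
  have hgpow : ∀ x, (g x ^ ((m : ℝ)⁻¹)) ^ m = g x := fun x =>
    Real.rpow_inv_natCast_pow (hg0 x) hm
  have hgle : ∀ x ∈ Icc e b, g x ≤ g e * (1 + k * (x - e)) ^ m := fun x hx => by
    nth_rw 1 [← hgpow x, ← hgpow e]
    rw [← mul_pow]
    exact pow_le_pow_left₀ (Real.rpow_nonneg (hg0 x) _) (htan x hx) m
  have hg1 : IntervalIntegrable g volume e t := hgint.mono_set (by
    rw [uIcc_of_le ht.1.le, uIcc_of_le he.2.le]
    exact Icc_subset_Icc_right ht.2)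
  have hg2 : IntervalIntegrable g volume t b := hgint.mono_set (by
    rw [uIcc_of_le ht.2, uIcc_of_le he.2.le]
    exact Icc_subset_Icc_left ht.1.le)
  rw [intervalIntegral.integral_const_mul] at htV
  have hmass := mass_eq_of_junction hm hge
    (intervalIntegral.integral_nonneg he.2.le fun x _ => hg0 x)
    (hL t ⟨ht.1.le, ht.2⟩) htV (by
      intro h0
      refine le_antisymm htV ?_
      rw [← intervalIntegral.integral_add_adjacent_intervals hg1 hg2,
        ← intervalIntegral.integral_const_mul]
      refine le_add_of_le_of_nonneg (intervalIntegral.integral_mono_on ht.1.le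
        (Continuous.intervalIntegrable (by fun_prop) _ _) hg1 fun x hx => ?_)
        (intervalIntegral.integral_nonneg ht.2 fun x _ => hg0 x)
      have hte : t - e ≠ 0 := (sub_pos.2 ht.1).ne'
      rw [← hk] at h0 ⊢
      have hLx : 1 + k * (x - e) = (t - x) / (t - e) := by
        rw [eq_div_iff hte]
        linear_combination (x - e) * h0
      nth_rw 1 [← hgpow x, ← hgpow e]
      rw [← mul_pow]
      refine pow_le_pow_left₀ (mul_nonneg hφe.le (hL x ⟨hx.1, hx.2.trans ht.2⟩)) ?_ m
      have hchord := hφ.2 (Ioo_subset_Icc_self he) ⟨he.1.le.trans ht.1.le, ht.2⟩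
        (div_nonneg (sub_nonneg.2 hx.2) (sub_nonneg.2 ht.1.le))
        (div_nonneg (sub_nonneg.2 hx.1) (sub_nonneg.2 ht.1.le)) (by field_simp; ring)
      have hcomb : ((t - x) / (t - e)) • e + ((x - e) / (t - e)) • t = x := by
        simp only [smul_eq_mul]
        field_simp
        ring
      rw [hcomb] at hchord
      refine le_trans ?_ hchord
      rw [hLx, smul_eq_mul, smul_eq_mul, mul_comm]
      exact le_add_of_nonneg_right (mul_nonneg
        (div_nonneg (sub_nonneg.2 hx.1) (sub_nonneg.2 ht.1.le)) (Real.rpow_nonneg (hg0 t) _)))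
    hsv hs0
  rw [← hk] at hmass
  have hP : EqOn (fun x => g e * (1 + k * (x - e)) ^ m) h (uIoc e s) := fun x hx => by
    rw [uIoc_of_le hs.1] at hx
    exact (hh x (Ioc_subset_Icc_self hx)).symm
  have hQ : EqOn (fun x => g e * (1 + k * (s - e)) ^ m * ((t - x) / (t - s)) ^ m) h
      (uIoc s t) := fun x hx => by
    rw [uIoc_of_le hs.2] at hx
    exact (hh' x hx).symm
  have hh1 : IntervalIntegrable h volume e s :=
    (Continuous.intervalIntegrable (by fun_prop) _ _).congr hP
  have hh2 : IntervalIntegrable h volume s t :=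
    (Continuous.intervalIntegrable (by fun_prop) _ _).congr hQ
  have hhint : ∫ x in e..b, g x = ∫ x in e..t, h x := by
    rw [← intervalIntegral.integral_add_adjacent_intervals hh1 hh2, ← hmass,
      ← intervalIntegral.integral_congr_ae (ae_of_all _ hP),
      ← intervalIntegral.integral_congr_ae (ae_of_all _ hQ),
      intervalIntegral.integral_const_mul, intervalIntegral.integral_const_mul]
    rcases hs.2.eq_or_lt with rfl | hst
    · simp
    · rw [integral_cone_pow hst]
  obtain ⟨c, hct, hc⟩ := exists_crossing_cone hm hφ hg0 he.1.le ht.2 hs.1 hs.2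
    (fun x hx => hgle x ⟨hx.1, hx.2.trans ht.2⟩) (hL s ⟨hs.1, hs.2.trans ht.2⟩) hh hh'
  exact ⟨hh1.trans hh2, integral_mul_le_of_crossing hct ht.1.le ht.2 hgint (hh1.trans hh2)
    (fun x _ => hg0 x) hc hhint⟩

theorem ConcaveOn.pos_of_mem_Ioo {a b e x : ℝ} {φ : ℝ → ℝ} (hφ : ConcaveOn ℝ (Icc a b) φ)
    (hφ0 : ∀ y, 0 ≤ φ y) (he : e ∈ Ioo a b) (hx : x ∈ Icc a b) (hpos : 0 < φ x) : 0 < φ e := by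
  by_contra! h
  have hab := he.1.trans he.2
  rcases lt_trichotomy x e with hxe | rfl | hex
  · have := hφ.left_le_of_le_right'' hx (right_mem_Icc.2 hab.le) hxe.le he.2 (h.trans (hφ0 b))
    linarith
  · linarith
  · have := hφ.right_le_of_le_left'' (left_mem_Icc.2 hab.le) hx he.1 hex.le (h.trans (hφ0 a))
    linarith



theorem stmt_5
    (n : ℕ) (hn : 2 ≤ n)
    (Δ : Set (ℝ × (Fin (n - 1) → ℝ)))
    (hΔcomp : IsCompact Δ) (hΔconv : Convex ℝ Δ)
    (hΔint : (interior Δ).Nonempty)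
    (t₀ t₁ : ℝ) (hproj : Prod.fst '' Δ = Icc t₀ t₁)
    (V : ℝ) (hV : V = (volume Δ).toReal)
    (b₁ : ℝ) (hb₁ : b₁ = (1 / V) * ∫ p in Δ, p.1)
    (g : ℝ → ℝ)
    (hg : ∀ x : ℝ, g x = (volume {y : Fin (n - 1) → ℝ | (x, y) ∈ Δ}).toReal)
    (e : ℝ) (he : e ∈ Ioo t₀ t₁)
    (v : ℝ)
    (hv : Tendsto (fun x => (g x - g e) / (x - e)) (nhdsWithin e (Ioi e)) (nhds v)
        ∨ Tendsto (fun x => (g x - g e) / (x - e)) (nhdsWithin e (Iio e)) (nhds v))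
    (h₀ : ℝ → ℝ)
    (hh₀ : ∀ x ∈ Icc t₀ e, h₀ x = g x)
    (hh₀' : ∀ x ∈ Icc e t₁,
      h₀ x = g e * (v * (x - e) / (((n : ℝ) - 1) * g e) + 1) ^ (n - 1))
    (t : ℝ) (ht : t ∈ Ioc e t₁)
    (htV : V ≤ ∫ x in t₀..t, h₀ x)
    (s₁ : ℝ)
    (hs₁v : v ≠ 0 → s₁ = e + (((n : ℝ) - 1) * g e / v) *
      ((((n : ℝ) * v * (V - ∫ x in t₀..e, g x) + ((n : ℝ) - 1) * g e ^ 2) /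
          (g e * (v * (t - e) + ((n : ℝ) - 1) * g e))) ^ ((1 : ℝ) / ((n : ℝ) - 1)) - 1))
    (hs₁0 : v = 0 → s₁ = ((n : ℝ) * (V - ∫ x in t₀..e, g x) - g e * (t - (n : ℝ) * e)) /
      (((n : ℝ) - 1) * g e))
    (hs₁mem : s₁ ∈ Icc e t)
    (h₁ : ℝ → ℝ)
    (hh₁ : ∀ x ∈ Icc t₀ s₁, h₁ x = h₀ x)
    (hh₁' : ∀ x ∈ Ioc s₁ t, h₁ x = h₀ s₁ * ((t - x) / (t - s₁)) ^ (n - 1)) :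
    b₁ ≥ (1 / V) * ∫ x in t₀..t, x * h₁ x := by
  have hm : n - 1 ≠ 0 := by omega
  have hn1 : (n : ℝ) - 1 = (n - 1 : ℕ) := by rw [Nat.cast_sub (by omega), Nat.cast_one]
  have hn' : (n : ℝ) = (n - 1 : ℕ) + 1 := by linarith
  rw [hn1, hn'] at hs₁v hs₁0
  rw [hn1] at hh₀'
  have hab : t₀ ≤ t₁ := (he.1.trans he.2).le
  have hconc := concaveOn_rpow_volume_slice hm hΔcomp hΔconv
  have hF1 := hΔcomp.setIntegral_fst_eq hab hproj (F := fun _ => 1) continuous_const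
  have hFx := hΔcomp.setIntegral_fst_eq hab hproj (F := fun x => x) continuous_id
  simp only [hproj, ← hg] at hconc
  simp only [one_mul, ← hg] at hF1
  simp only [← hg] at hFx
  have hg0 : ∀ x, 0 ≤ g x := fun x => hg x ▸ ENNReal.toReal_nonneg
  have hVg : V = ∫ x in t₀..t₁, g x := by
    rw [← hF1.2, hV]
    simp [Measure.real]
  have hVpos : 0 < V := by
    rw [hV]
    exact ENNReal.toReal_pos (Measure.measure_pos_of_nonempty_interior _ hΔint).ne'
      hΔcomp.measure_lt_top.ne
  have hge : 0 < g e := by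
    obtain ⟨x, hx, hgx⟩ : ∃ x ∈ Icc t₀ t₁, 0 < g x := by
      by_contra! hcon
      refine hVpos.not_ge ?_
      rw [hVg, intervalIntegral.integral_of_le hab]
      exact setIntegral_nonpos measurableSet_Ioc fun x hx => hcon x (Ioc_subset_Icc_self hx)
    have := hconc.pos_of_mem_Ioo (fun y => Real.rpow_nonneg (hg0 y) _) he hx
      (Real.rpow_pos_of_pos hgx _)
    refine (hg0 e).lt_of_ne fun h0 => ?_
    have hinv : ((n - 1 : ℕ) : ℝ)⁻¹ ≠ 0 := by positivity
    have hpow : g e ^ (((n - 1 : ℕ) : ℝ)⁻¹) = 0 := by rw [← h0, Real.zero_rpow hinv]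
    exact this.ne' hpow
  have hg1 : IntervalIntegrable g volume t₀ e := hF1.1.mono_set (by
    rw [uIcc_of_le he.1.le, uIcc_of_le hab]
    exact Icc_subset_Icc_right he.2.le)
  have hg2 : IntervalIntegrable g volume e t₁ := hF1.1.mono_set (by
    rw [uIcc_of_le he.2.le, uIcc_of_le hab]
    exact Icc_subset_Icc_left he.1.le)
  have hW : V - ∫ x in t₀..e, g x = ∫ x in e..t₁, g x := by
    rw [hVg, ← intervalIntegral.integral_add_adjacent_intervals hg1 hg2]
    ring
  rw [hW] at hs₁v hs₁0
  have hP : ∀ x ∈ Icc e t₁, h₀ x = g e * (1 + v / ((n - 1 : ℕ) * g e) * (x - e)) ^ (n - 1) := fun x hx => by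
    rw [hh₀' x hx, add_comm (1 : ℝ), mul_div_right_comm]
  have hh₀e : EqOn g h₀ (uIoc t₀ e) := fun x hx => by
    rw [uIoc_of_le he.1.le] at hx
    exact (hh₀ x (Ioc_subset_Icc_self hx)).symm
  have hPe : EqOn (fun x => g e * (1 + v / ((n - 1 : ℕ) * g e) * (x - e)) ^ (n - 1)) h₀ (uIoc e t) :=
    fun x hx => by
      rw [uIoc_of_le ht.1.le] at hx
      exact (hP x ⟨hx.1.le, hx.2.trans ht.2⟩).symm
  have hmass : ∫ x in e..t₁, g x ≤ ∫ x in e..t, g e * (1 + v / ((n - 1 : ℕ) * g e) * (x - e)) ^ (n - 1) := by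
    rw [← intervalIntegral.integral_add_adjacent_intervals (hg1.congr hh₀e)
      ((Continuous.intervalIntegrable (by fun_prop) _ _).congr hPe),
      ← intervalIntegral.integral_congr_ae (ae_of_all _ hh₀e),
      ← intervalIntegral.integral_congr_ae (ae_of_all _ hPe)] at htV
    linarith
  have hs₁mem' : s₁ ∈ Icc e t₁ := ⟨hs₁mem.1, hs₁mem.2.trans ht.2⟩
  obtain ⟨hint, hle⟩ := integral_mul_cone_le (h := h₁) hm hconc hg0 hg2 he hge hv ht hmass
    hs₁v hs₁0 hs₁mem
    (fun x hx => by
      rw [hh₁ x ⟨he.1.le.trans hx.1, hx.2⟩, hP x ⟨hx.1, hx.2.trans hs₁mem'.2⟩])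
    (fun x hx => by rw [hh₁' x hx, hP s₁ hs₁mem'])
  have hh₁e : EqOn (fun x => x * g x) (fun x => x * h₁ x) (uIoc t₀ e) := fun x hx => by
    rw [uIoc_of_le he.1.le] at hx
    simp only [hh₁ x ⟨hx.1.le, hx.2.trans hs₁mem.1⟩, hh₀ x (Ioc_subset_Icc_self hx)]
  have hxg1 := hg1.continuousOn_mul (continuousOn_id (s := uIcc t₀ e))
  have hxg2 := hg2.continuousOn_mul (continuousOn_id (s := uIcc e t₁))
  have hxh := hint.continuousOn_mul (continuousOn_id (s := uIcc e t))
  simp only [id] at hxg1 hxg2 hxh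
  rw [hb₁, hFx.2, ge_iff_le]
  refine mul_le_mul_of_nonneg_left ?_ (by positivity)
  rw [← intervalIntegral.integral_add_adjacent_intervals (hxg1.congr hh₁e) hxh,
    ← intervalIntegral.integral_add_adjacent_intervals hxg1 hxg2,
    ← intervalIntegral.integral_congr_ae (ae_of_all _ hh₁e)]
  linarith
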